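/- arXiv:2409.19857 — 2 statements merged into one kernel-verified Lean document; each statement's English description precedes it below -/
import Mathlib

section
/- The orthogonal complement of K in Λ is negative definite: if x ∈ Λ satisfies ⟨x, K⟩ = 0 and x ≠ 0, then ⟨x, x⟩ < 0. -/
namespace ConicOrder

/-- The Picard lattice `Λ = ℤ⁸` of the blow-up of `ℙ²` at 7 general points,
with coordinates `(L, E₁, …, E₇)`. -/
abbrev Lam : Type := Fin 8 → ℤ

/-- The intersection form: `⟨L,L⟩ = 1`, `⟨Eᵢ,Eᵢ⟩ = −1`, distinct basis vectors orthogonal. -/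
def form (x y : Lam) : ℤ := x 0 * y 0 - ∑ i : Fin 7, x i.succ * y i.succ

/-- The class `L` of a line. -/
def Lv : Lam := fun j => if j = 0 then 1 else 0

/-- The exceptional basis classes `E₁, …, E₇` (indexed by `Fin 7`). -/
def Ev (i : Fin 7) : Lam := fun j => if j = i.succ then 1 else 0

/-- The canonical class `K = −3L + E₁ + ⋯ + E₇`. -/
def K : Lam := fun j => if j = 0 then -3 else 1

/-- The Geiser involution `σ(x) = ⟨x,K⟩·K − x`. -/
def σ (x : Lam) : Lam := form x K • K - x

/-- A class `e` is exceptional if `⟨e,e⟩ = −1` and `⟨e,K⟩ = −1`. -/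
def IsExceptional (e : Lam) : Prop := form e e = -1 ∧ form e K = -1

/-- the orthogonal complement of `K` in `Λ` is negative definite. -/
theorem orthogonal_complement_K_negative_definite (x : Lam)
    (hK : form x K = 0) (hx : x ≠ 0) : form x x < 0 := by
  have hsum : ∑ i : Fin 7, x i.succ = -3 * x 0 := by
    have h : x 0 * -3 - ∑ i : Fin 7, x i.succ = 0 := by
      simpa [form, K, Fin.succ_ne_zero] using hK
    linarith
  have hcs : (∑ i : Fin 7, x i.succ) ^ 2 ≤ 7 * ∑ i : Fin 7, x i.succ ^ 2 := by
    simpa using sq_sum_le_card_mul_sum_sq (s := Finset.univ) (f := fun i : Fin 7 => x i.succ)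
  rw [hsum] at hcs
  by_contra! hnonneg
  have hle : ∑ i : Fin 7, x i.succ ^ 2 ≤ x 0 ^ 2 := by
    simpa [form, ← pow_two] using hnonneg
  have h0 : x 0 = 0 := by
    have : x 0 ^ 2 = 0 := by nlinarith [sq_nonneg (x 0)]
    simpa using this
  have hsq : ∑ i : Fin 7, x i.succ ^ 2 = 0 :=
    le_antisymm (by simpa [h0] using hle) (Finset.sum_nonneg fun i _ => sq_nonneg _)
  have hsucc (i : Fin 7) : x i.succ = 0 := by
    simpa using (Finset.sum_eq_zero_iff_of_nonneg fun i _ => sq_nonneg (x (Fin.succ i))).1 hsq i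
      (Finset.mem_univ i)
  exact hx (funext (Fin.cases h0 hsucc))

end ConicOrder
end

section
/- The image of the endomorphism (1 − σ) of Λ equals the subgroup of Λ generated by all elements 2v with v ∈ ker(1 + σ) together with the single element h + e₂ + e₄ + e₆, where h := L − 3E₁ and eᵢ := Eᵢ − Eᵢ₊₁. -/
namespace ConicOrder

/-- `h = L − 3E₁`. -/
def hgen : Lam := Lv - (3 : ℤ) • Ev 0

/-- `eᵢ = Eᵢ − Eᵢ₊₁` for `i = 1, …, 6` (here indexed by `Fin 6`, so `egen 0 = e₁`, …,
`egen 5 = e₆`). -/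
def egen (i : Fin 6) : Lam := Ev i.castSucc - Ev i.succ

lemma form_add_left (x y z : Lam) : form (x + y) z = form x z + form y z := by
  simp only [form, Pi.add_apply, add_mul, Finset.sum_add_distrib]
  ring

lemma form_smul_left (n : ℤ) (x z : Lam) : form (n • x) z = n * form x z := by
  simp only [form, Pi.smul_apply, smul_eq_mul, mul_assoc, mul_sub, Finset.mul_sum]

lemma add_sigma_eq_zero_iff (x : Lam) : x + σ x = 0 ↔ form x K = 0 := by
  have hx : x + σ x = form x K • K := by simp [σ]
  have hK : K ≠ 0 := fun h => by simpa [K] using congrFun h 0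
  rw [hx, smul_eq_zero, or_iff_left hK]

lemma sub_sigma (x : Lam) : x - σ x = (2 : ℤ) • x - form x K • K := by
  rw [σ]
  module

/-- The endomorphism `1 − σ` of `Λ`. -/
def oneSubSigma : Lam →+ Lam where
  toFun x := x - σ x
  map_zero' := by simp [σ, form]
  map_add' x y := by
    simp only [sub_sigma, form_add_left]
    module

/-- A class of degree `1` against `K` that `1 − σ` sends to `h + e₂ + e₄ + e₆`. -/
def glueClass : Lam := ![-1, -1, 1, 0, 1, 0, 1, 0]

lemma form_glueClass_K : form glueClass K = 1 := by decide

lemma sub_sigma_glueClass :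
    glueClass - σ glueClass = hgen + egen 1 + egen 3 + egen 5 := by decide

/-- `im(1 − σ)` equals the subgroup generated by `2·ker(1 + σ)`
together with the single element `h + e₂ + e₄ + e₆`. -/
theorem im_one_minus_sigma_description :
    Set.range (fun x : Lam => x - σ x) =
      ((AddSubgroup.closure
          ((fun v : Lam => (2 : ℤ) • v) '' {x : Lam | x + σ x = 0} ∪
            {hgen + egen 1 + egen 3 + egen 5}) : AddSubgroup Lam) : Set Lam) := by
  rw [← sub_sigma_glueClass]
  apply Set.Subset.antisymm
  · rintro _ ⟨x, rfl⟩
    have hv : form (x + (-form x K) • glueClass) K = 0 := by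
      rw [form_add_left, form_smul_left, form_glueClass_K]
      ring
    have hx : x - σ x = (2 : ℤ) • (x + (-form x K) • glueClass) +
        form x K • (glueClass - σ glueClass) := by
      rw [sub_sigma, sub_sigma, form_glueClass_K]
      module
    simp only [hx, SetLike.mem_coe]
    refine add_mem (AddSubgroup.subset_closure ?_)
      (zsmul_mem (AddSubgroup.subset_closure ?_) _)
    · exact Or.inl ⟨_, (add_sigma_eq_zero_iff _).2 hv, rfl⟩
    · exact Or.inr rfl
  · change _ ⊆ (oneSubSigma.range : Set Lam)
    rw [SetLike.coe_subset_coe, AddSubgroup.closure_le]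
    rintro _ (⟨v, hv, rfl⟩ | rfl)
    · refine ⟨v, (sub_sigma v).trans ?_⟩
      rw [(add_sigma_eq_zero_iff v).1 hv, zero_smul, sub_zero]
    · exact ⟨glueClass, rfl⟩

end ConicOrder
end
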